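/- Let 1 ≤ q < 2 and let a = (a_n)_{n∈ℤ} be a summable complex sequence. Then ‖ Σ_{n∈ℤ} a_n e^{2πin·} ‖_{L^{2,q}[0,1)} ≤ K(q) · ( Σ_{n=1}^∞ ( Σ_{j=n}^∞ (a_j^{**})² )^{q/2} · ( n · log^{q/2}(n+1) )^{−1} )^{1/q}, where (a_j^*)_{j≥1} is the decreasing rearrangement of (|a_n|)_{n∈ℤ}, a_j^{**} = (1/j) Σ_{i=1}^j a_i^*, ‖g‖_{L^{2,q}[0,1)} = ( ∫_0^1 ( t^{1/2} g^{**}(t) )^q dt/t )^{1/q} with g^{**}(t) = (1/t)∫_0^t g^*(s) ds, and K(q) depends only on q. -/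

import Mathlib

open MeasureTheory ENNReal Set

noncomputable section

/-- `enn f x = |f x|` as an extended nonnegative real number. -/
def enn {α : Type*} (f : α → ℂ) : α → ℝ≥0∞ := fun x => ENNReal.ofReal ‖f x‖

/-- Decreasing rearrangement of an `ℝ≥0∞`-valued function. -/
def rearr {α : Type*} [MeasurableSpace α] (μ : Measure α) (h : α → ℝ≥0∞) (t : ℝ) : ℝ≥0∞ :=
  sInf {l : ℝ≥0∞ | μ {x | l < h x} ≤ ENNReal.ofReal t}

/-- The Fourier series `x ↦ ∑_{n ∈ ℤ} a_n e^{2πinx}` of a sequence `a`. -/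
def FSeries (a : ℤ → ℂ) (x : ℝ) : ℂ :=
  ∑' n : ℤ, a n * Complex.exp (((2 * Real.pi * ((n : ℝ) * x) : ℝ) : ℂ) * Complex.I)

/-- The `(j+1)`-th largest value of a sequence `a : ℤ → ℝ≥0∞` (so `seqRearr a 0` is the
largest). -/
def seqRearr (a : ℤ → ℝ≥0∞) (j : ℕ) : ℝ≥0∞ :=
  sInf {l : ℝ≥0∞ | Measure.count {n : ℤ | l < a n} ≤ (j : ℝ≥0∞)}

/-- `a_j^{**} = (1/j) ∑_{i=1}^j a_i^*`, for `j ≥ 1` (here `a_i^* = seqRearr a (i-1)`). -/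
def seqMaxRearr (a : ℤ → ℝ≥0∞) (j : ℕ) : ℝ≥0∞ :=
  (j : ℝ≥0∞)⁻¹ * ∑ i ∈ Finset.range j, seqRearr a i

/-- `g^*`, the decreasing rearrangement of `g` on `(0,1)`. -/
def circRearr (g : ℝ → ℂ) : ℝ → ℝ≥0∞ :=
  rearr (volume.restrict (Ico (0:ℝ) 1)) (enn g)

/-- `g^{**}(t) = (1/t) ∫_0^t g^*`. -/
def circMaxRearr (g : ℝ → ℂ) (t : ℝ) : ℝ≥0∞ :=
  (ENNReal.ofReal t)⁻¹ * ∫⁻ s in Ioo (0:ℝ) t, circRearr g s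

/-- The Lorentz norm `‖g‖_{L^{2,q}[0,1)} = (∫_0^1 (t^{1/2} g^{**}(t))^q dt/t)^{1/q}`. -/
def lorentz2 (q : ℝ) (g : ℝ → ℂ) : ℝ≥0∞ :=
  (∫⁻ t in Ioo (0:ℝ) 1,
      (ENNReal.ofReal (t ^ ((1:ℝ) / 2)) * circMaxRearr g t) ^ q * (ENNReal.ofReal t)⁻¹) ^ (1 / q)

theorem lintegral_eq_lintegral_ofReal_lt {α : Type*} [MeasurableSpace α] {μ : Measure α}
    {f : α → ℝ≥0∞} (hf : Measurable f) (hf' : ∀ x, f x ≠ ∞) :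
    ∫⁻ x, f x ∂μ = ∫⁻ t in Ioi (0:ℝ), μ {x | ENNReal.ofReal t < f x} := by
  have h1 := lintegral_eq_lintegral_meas_lt μ (f := fun x => (f x).toReal)
    (Filter.Eventually.of_forall fun x => ENNReal.toReal_nonneg) hf.ennreal_toReal.aemeasurable
  simp only [ENNReal.ofReal_toReal (hf' _)] at h1
  rw [h1]
  refine setLIntegral_congr_fun measurableSet_Ioi fun t ht => ?_
  simp only [ENNReal.ofReal_lt_iff_lt_toReal (le_of_lt ht) (hf' _)]

theorem lintegral_le_of_meas_lt_le {α β : Type*} [MeasurableSpace α] [MeasurableSpace β]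
    {μ : Measure α} {ν : Measure β} {f : α → ℝ≥0∞} {g : β → ℝ≥0∞}
    (hf : Measurable f) (hg : Measurable g) (hf' : ∀ x, f x ≠ ∞) (hg' : ∀ x, g x ≠ ∞)
    (h : ∀ l : ℝ≥0∞, μ {x | l < f x} ≤ ν {x | l < g x}) :
    ∫⁻ x, f x ∂μ ≤ ∫⁻ x, g x ∂ν := by
  rw [lintegral_eq_lintegral_ofReal_lt hf hf', lintegral_eq_lintegral_ofReal_lt hg hg']
  exact lintegral_mono fun t => h _

theorem lintegral_sq_le_of_meas_lt_le {α β : Type*} [MeasurableSpace α] [MeasurableSpace β]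
    {μ : Measure α} {ν : Measure β} {f : α → ℝ≥0∞} {g : β → ℝ≥0∞}
    (hf : Measurable f) (hg : Measurable g) (hf' : ∀ x, f x ≠ ∞) (hg' : ∀ x, g x ≠ ∞)
    (h : ∀ l : ℝ≥0∞, μ {x | l < f x} ≤ ν {x | l < g x}) :
    ∫⁻ x, f x ^ (2:ℝ) ∂μ ≤ ∫⁻ x, g x ^ (2:ℝ) ∂ν := by
  refine lintegral_le_of_meas_lt_le (hf.pow_const _) (hg.pow_const _)
    (fun x => ENNReal.rpow_ne_top_of_nonneg (by norm_num) (hf' x))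
    (fun x => ENNReal.rpow_ne_top_of_nonneg (by norm_num) (hg' x)) fun l => ?_
  have e : ∀ y : ℝ≥0∞, l < y ^ (2:ℝ) ↔ l ^ ((2:ℝ)⁻¹) < y := fun y => by
    rw [ENNReal.rpow_inv_lt_iff (by norm_num)]
  simp only [e]
  exact h _

theorem measure_sInf_lt_le {α : Type*} [MeasurableSpace α] (μ : Measure α) (h : α → ℝ≥0∞)
    (c : ℝ≥0∞) : μ {x | sInf {l : ℝ≥0∞ | μ {x | l < h x} ≤ c} < h x} ≤ c := by
  set A := {l : ℝ≥0∞ | μ {x | l < h x} ≤ c} with hA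
  have hne : A.Nonempty := ⟨⊤, by simp [hA]⟩
  obtain ⟨u, hu, hlim, hmem⟩ := exists_seq_tendsto_sInf hne (OrderBot.bddBelow A)
  have e : {x | sInf A < h x} ⊆ ⋃ n, {x | u n < h x} := by
    intro x hx
    obtain ⟨n, hn⟩ := (hlim.eventually (gt_mem_nhds hx)).exists
    exact mem_iUnion.2 ⟨n, hn⟩
  refine (measure_mono e).trans ?_
  have hmono : Monotone fun n => {x | u n < h x} := fun m n hmn x hx =>
    lt_of_le_of_lt (hu hmn) hx
  rw [hmono.measure_iUnion]
  exact iSup_le fun n => hmem n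

theorem antitone_rearr {α : Type*} [MeasurableSpace α] (μ : Measure α) (h : α → ℝ≥0∞) :
    Antitone (rearr μ h) := fun _ _ hst =>
  sInf_le_sInf fun _ hl => le_trans hl (ENNReal.ofReal_le_ofReal hst)

theorem antitone_seqRearr (b : ℤ → ℝ≥0∞) : Antitone (seqRearr b) := fun _ _ hst =>
  sInf_le_sInf fun _ hl => le_trans (mem_ofPred.1 hl) (Nat.cast_le.2 hst)

theorem volume_lt_rearr_le {α : Type*} [MeasurableSpace α] (μ : Measure α) (h : α → ℝ≥0∞)
    (l : ℝ≥0∞) : volume.restrict (Ioi (0:ℝ)) {s | l < rearr μ h s} ≤ μ {x | l < h x} := by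
  rcases eq_or_ne (μ {x | l < h x}) ∞ with hm | hm
  · simp [hm]
  have hsub : {s | l < rearr μ h s} ∩ Ioi (0:ℝ) ⊆ Ioo 0 (μ {x | l < h x}).toReal := by
    rintro s ⟨hs, hs0⟩
    refine ⟨hs0, ?_⟩
    by_contra! hcon
    exact absurd (sInf_le (show l ∈ {l : ℝ≥0∞ | μ {x | l < h x} ≤ ENNReal.ofReal s} from
      (ENNReal.le_ofReal_iff_toReal_le hm (le_of_lt hs0)).2 hcon)) (not_le.2 hs)
  rw [Measure.restrict_apply' measurableSet_Ioi]
  refine (measure_mono hsub).trans ?_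
  rw [Real.volume_Ioo, sub_zero, ENNReal.ofReal_toReal hm]

theorem count_le_count_of_forall_lt {E : Set ℤ} {P : Set ℕ}
    (h : ∀ j : ℕ, (j : ℝ≥0∞) < Measure.count E → j ∈ P) :
    Measure.count E ≤ Measure.count P := by
  rcases E.finite_or_infinite with hE | hE
  · have h1 : Measure.count E = (hE.toFinset.card : ℝ≥0∞) := Measure.count_apply_finite _ hE
    rw [h1] at h ⊢
    have : ((Finset.range hE.toFinset.card : Finset ℕ) : Set ℕ) ⊆ P := by
      intro j hj
      exact h j (by exact_mod_cast Finset.mem_range.1 (Finset.mem_coe.1 hj))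
    refine le_trans ?_ (measure_mono this)
    rw [Measure.count_apply_finset, Finset.card_range]
  · rw [Measure.count_apply_infinite hE] at h ⊢
    have : P = univ := eq_univ_of_forall fun j => h j (ENNReal.natCast_lt_top j)
    rw [this, Measure.count_apply_infinite infinite_univ]

theorem lt_seqRearr {b : ℤ → ℝ≥0∞} {l : ℝ≥0∞} {j : ℕ}
    (h : (j : ℝ≥0∞) < Measure.count {n : ℤ | l < b n}) : l < seqRearr b j := by
  by_contra! hcon
  refine absurd h (not_lt.2 (le_trans (measure_mono ?_) (measure_sInf_lt_le Measure.count b j)))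
  intro n hn
  exact lt_of_le_of_lt hcon hn

theorem seqRearr_ne_top {b : ℤ → ℝ≥0∞} {B : ℝ≥0∞} (hB : B ≠ ∞) (hb : ∀ n, b n ≤ B) (j : ℕ) :
    seqRearr b j ≠ ∞ :=
  ne_top_of_le_ne_top hB (sInf_le (by simp [not_lt.2 (hb _)]))

/-- The part of `b` above its `(N+1)`-th largest value sums to at most the `N` largest values. -/
theorem tsum_indicator_lt_seqRearr_le {b : ℤ → ℝ≥0∞} {B : ℝ≥0∞} (hB : B ≠ ∞)
    (hb : ∀ n, b n ≤ B) (N : ℕ) :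
    ∑' n, (if seqRearr b N < b n then b n else 0) ≤ ∑ j ∈ Finset.range N, seqRearr b j := by
  have h1 : ∑ j ∈ Finset.range N, seqRearr b j
      = ∑' j, if j < N then seqRearr b j else 0 := by
    rw [tsum_eq_sum (s := Finset.range N) (by intro j hj; simp_all)]
    exact Finset.sum_congr rfl fun j hj => by simp_all
  rw [h1, ← lintegral_count, ← lintegral_count]
  refine lintegral_le_of_meas_lt_le (measurable_of_countable _) (measurable_of_countable _)
    (fun n => ?_) (fun j => ?_) fun l => ?_
  · split_ifs
    exacts [ne_top_of_le_ne_top hB (hb n), by simp]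
  · split_ifs
    exacts [seqRearr_ne_top hB hb j, by simp]
  · have hsub : {n : ℤ | l < if seqRearr b N < b n then b n else 0}
        ⊆ {n | max l (seqRearr b N) < b n} := by
      intro n hn
      simp only [mem_ofPred_eq] at hn ⊢
      split_ifs at hn with h
      · exact max_lt hn h
      · simp at hn
    refine (measure_mono hsub).trans (count_le_count_of_forall_lt fun j hj => ?_)
    have h2 := max_lt_iff.1 (lt_seqRearr hj)
    have h3 : j < N := by
      by_contra! hcon
      exact absurd h2.2 (not_lt.2 (antitone_seqRearr b hcon))
    simp [h3, h2.1]

theorem tsum_sq_indicator_le_seqRearr_le {b : ℤ → ℝ≥0∞} {B : ℝ≥0∞} (hB : B ≠ ∞)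
    (hb : ∀ n, b n ≤ B) (N : ℕ) :
    ∑' n, (if seqRearr b N < b n then 0 else b n) ^ (2:ℝ) ≤
      N * seqRearr b N ^ (2:ℝ) + ∑' j, seqRearr b (j + N) ^ (2:ℝ) := by
  have h1 : ∑' j, (min (seqRearr b j) (seqRearr b N)) ^ (2:ℝ) ≤
      N * seqRearr b N ^ (2:ℝ) + ∑' j, seqRearr b (j + N) ^ (2:ℝ) := by
    rw [← ENNReal.summable.sum_add_tsum_nat_add' (k := N)]
    gcongr
    · refine (Finset.sum_le_card_nsmul _ _ (seqRearr b N ^ (2:ℝ)) fun j _ => ?_).trans (by simp)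
      gcongr
      exact min_le_right _ _
    · exact min_le_left _ _
  refine le_trans ?_ h1
  rw [← lintegral_count, ← lintegral_count]
  refine lintegral_sq_le_of_meas_lt_le (measurable_of_countable _) (measurable_of_countable _)
    (fun n => ?_) (fun j => ?_) fun l => ?_
  · split_ifs
    exacts [by simp, ne_top_of_le_ne_top hB (hb n)]
  · exact ne_top_of_le_ne_top (seqRearr_ne_top hB hb j) (min_le_left _ _)
  · by_cases hl : l < seqRearr b N
    · have hsub : {n : ℤ | l < if seqRearr b N < b n then 0 else b n} ⊆ {n | l < b n} := by
        intro n hn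
        simp only [mem_ofPred_eq] at hn ⊢
        split_ifs at hn with h
        · simp at hn
        · exact hn
      refine (measure_mono hsub).trans (count_le_count_of_forall_lt fun j hj => ?_)
      exact lt_min (lt_seqRearr hj) hl
    · have : {n : ℤ | l < if seqRearr b N < b n then 0 else b n} = ∅ := by
        refine eq_empty_of_forall_notMem fun n hn => ?_
        simp only [mem_ofPred_eq] at hn
        split_ifs at hn with h
        · simp at hn
        · exact hl (lt_of_lt_of_le hn (not_lt.1 h))
      simp [this]

theorem setLIntegral_ofReal_rpow_Ioi {a c : ℝ} (ha : a < -1) (hc : 0 < c) :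
    ∫⁻ t in Ioi c, ENNReal.ofReal (t ^ a) = ENNReal.ofReal (-c ^ (a + 1) / (a + 1)) := by
  rw [← integral_Ioi_rpow_of_lt ha hc,
    ofReal_integral_eq_lintegral_ofReal (integrableOn_Ioi_rpow_of_lt ha hc)]
  filter_upwards [self_mem_ae_restrict measurableSet_Ioi] with t ht
  exact Real.rpow_nonneg (hc.trans ht).le _

theorem setLIntegral_ofReal_rpow_Ioo {a c : ℝ} (ha : -1 < a) (hc : 0 < c) :
    ∫⁻ t in Ioo 0 c, ENNReal.ofReal (t ^ a) = ENNReal.ofReal (c ^ (a + 1) / (a + 1)) := by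
  have h1 : IntervalIntegrable (fun t : ℝ => t ^ a) volume 0 c :=
    intervalIntegral.intervalIntegrable_rpow' ha
  have h2 : ∫ t in Ioo 0 c, t ^ a = c ^ (a + 1) / (a + 1) := by
    rw [← integral_Ioc_eq_integral_Ioo, ← intervalIntegral.integral_of_le hc.le,
      integral_rpow (Or.inl ha), Real.zero_rpow (by linarith), sub_zero]
  rw [← h2, ofReal_integral_eq_lintegral_ofReal]
  · exact ((intervalIntegrable_iff_integrableOn_Ioc_of_le hc.le).1 h1).mono_set Ioo_subset_Ioc_self
  filter_upwards [self_mem_ae_restrict measurableSet_Ioo] with t ht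
  exact Real.rpow_nonneg ht.1.le _

/-- The weighted Cauchy–Schwarz bound behind Hardy's inequality. -/
theorem sq_average_le {φ : ℝ → ℝ≥0∞} (hφ : Measurable φ) {t : ℝ} (ht : 0 < t) :
    ((ENNReal.ofReal t)⁻¹ * ∫⁻ s in Ioo 0 t, φ s) ^ (2:ℝ) ≤
      ENNReal.ofReal (2 * t ^ (-(3:ℝ) / 2)) *
        ∫⁻ s in Ioo 0 t, φ s ^ (2:ℝ) * ENNReal.ofReal (s ^ ((1:ℝ) / 2)) := by
  have hCS := ENNReal.lintegral_mul_le_Lp_mul_Lq (volume.restrict (Ioo 0 t))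
    Real.HolderConjugate.two_two
    (f := fun s => φ s * ENNReal.ofReal (s ^ ((1:ℝ) / 4)))
    (g := fun s => ENNReal.ofReal (s ^ (-(1:ℝ) / 4)))
    (by fun_prop) (by fun_prop)
  have e1 : ∫⁻ s in Ioo 0 t, ((fun s => φ s * ENNReal.ofReal (s ^ ((1:ℝ) / 4))) *
      fun s => ENNReal.ofReal (s ^ (-(1:ℝ) / 4))) s = ∫⁻ s in Ioo 0 t, φ s := by
    refine setLIntegral_congr_fun measurableSet_Ioo fun s hs => ?_
    simp only [Pi.mul_apply]
    rw [mul_assoc, ← ENNReal.ofReal_mul (Real.rpow_nonneg hs.1.le _), ← Real.rpow_add hs.1]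
    norm_num
  have e2 : ∫⁻ s in Ioo 0 t, (φ s * ENNReal.ofReal (s ^ ((1:ℝ) / 4))) ^ (2:ℝ) =
      ∫⁻ s in Ioo 0 t, φ s ^ (2:ℝ) * ENNReal.ofReal (s ^ ((1:ℝ) / 2)) := by
    refine setLIntegral_congr_fun measurableSet_Ioo fun s hs => ?_
    rw [ENNReal.mul_rpow_of_nonneg _ _ (by norm_num),
      ENNReal.ofReal_rpow_of_pos (Real.rpow_pos_of_pos hs.1 _), ← Real.rpow_mul hs.1.le]
    norm_num
  have e3 : ∫⁻ s in Ioo 0 t, ENNReal.ofReal (s ^ (-(1:ℝ) / 4)) ^ (2:ℝ) =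
      ENNReal.ofReal (2 * t ^ ((1:ℝ) / 2)) := by
    have : ∫⁻ s in Ioo 0 t, ENNReal.ofReal (s ^ (-(1:ℝ) / 4)) ^ (2:ℝ) =
        ∫⁻ s in Ioo 0 t, ENNReal.ofReal (s ^ (-(1:ℝ) / 2)) := by
      refine setLIntegral_congr_fun measurableSet_Ioo fun s hs => ?_
      rw [ENNReal.ofReal_rpow_of_pos (Real.rpow_pos_of_pos hs.1 _), ← Real.rpow_mul hs.1.le]
      norm_num
    rw [this, setLIntegral_ofReal_rpow_Ioo (by norm_num) ht]
    congr 1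
    norm_num
    ring
  rw [e1, e2, e3] at hCS
  have hsq : (∫⁻ s in Ioo 0 t, φ s) ^ (2:ℝ) ≤
      (∫⁻ s in Ioo 0 t, φ s ^ (2:ℝ) * ENNReal.ofReal (s ^ ((1:ℝ) / 2))) *
        ENNReal.ofReal (2 * t ^ ((1:ℝ) / 2)) := by
    refine (ENNReal.rpow_le_rpow hCS (by norm_num)).trans_eq ?_
    rw [ENNReal.mul_rpow_of_nonneg _ _ (by norm_num), ← ENNReal.rpow_mul, ← ENNReal.rpow_mul]
    norm_num
  rw [ENNReal.mul_rpow_of_nonneg _ _ (by norm_num)]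
  refine (mul_le_mul_right hsq _).trans_eq ?_
  rw [mul_left_comm, mul_comm (ENNReal.ofReal (2 * t ^ (-(3:ℝ) / 2))),
    ← ENNReal.ofReal_inv_of_pos ht, ENNReal.ofReal_rpow_of_pos (inv_pos.2 ht),
    ← ENNReal.ofReal_mul (by positivity)]
  congr 2
  rw [← Real.rpow_neg_one t, ← Real.rpow_mul ht.le, mul_left_comm, ← Real.rpow_add ht]
  norm_num

theorem hardy_sq {φ : ℝ → ℝ≥0∞} (hφ : Measurable φ) :
    ∫⁻ t in Ioi (0:ℝ), ((ENNReal.ofReal t)⁻¹ * ∫⁻ s in Ioo 0 t, φ s) ^ (2:ℝ) ≤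
      4 * ∫⁻ s in Ioi (0:ℝ), φ s ^ (2:ℝ) := by
  let k : ℝ → ℝ → ℝ≥0∞ := fun t s => ({p : ℝ × ℝ | p.2 < p.1}.indicator fun p =>
    ENNReal.ofReal (2 * p.1 ^ (-(3:ℝ) / 2)) *
      (φ p.2 ^ (2:ℝ) * ENNReal.ofReal (p.2 ^ ((1:ℝ) / 2)))) (t, s)
  have hk : Measurable (Function.uncurry k) :=
    Measurable.indicator (by fun_prop) (measurableSet_lt measurable_snd measurable_fst)
  calc ∫⁻ t in Ioi (0:ℝ), ((ENNReal.ofReal t)⁻¹ * ∫⁻ s in Ioo 0 t, φ s) ^ (2:ℝ)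
      ≤ ∫⁻ t in Ioi (0:ℝ), ∫⁻ s in Ioi (0:ℝ), k t s := by
        refine setLIntegral_mono' measurableSet_Ioi fun t ht => (sq_average_le hφ ht).trans_eq ?_
        rw [← lintegral_const_mul _ (by fun_prop), ← Ioi_inter_Iio, ← Set.inter_comm,
          ← Measure.restrict_restrict measurableSet_Iio, ← lintegral_indicator measurableSet_Iio]
        rfl
    _ = ∫⁻ s in Ioi (0:ℝ), ∫⁻ t in Ioi (0:ℝ), k t s :=
        lintegral_lintegral_swap hk.aemeasurable
    _ = ∫⁻ s in Ioi (0:ℝ), 4 * φ s ^ (2:ℝ) := by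
        refine setLIntegral_congr_fun measurableSet_Ioi fun s hs => ?_
        have hs' : 0 < s := hs
        have e : ∀ t, k t s = (Ioi s).indicator (fun t => ENNReal.ofReal (t ^ (-(3:ℝ) / 2)) *
            (2 * (φ s ^ (2:ℝ) * ENNReal.ofReal (s ^ ((1:ℝ) / 2))))) t := by
          intro t
          simp only [k, indicator, mem_ofPred_eq, mem_Ioi]
          split_ifs with h
          · rw [ENNReal.ofReal_mul (by norm_num), ENNReal.ofReal_ofNat]
            ring
          · rfl
        simp only [e]
        rw [lintegral_indicator measurableSet_Ioi, Measure.restrict_restrict measurableSet_Ioi,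
          inter_eq_left.2 (Ioi_subset_Ioi hs'.le), lintegral_mul_const _ (by fun_prop),
          setLIntegral_ofReal_rpow_Ioi (by norm_num) hs']
        have e2 : ENNReal.ofReal (-s ^ (-(3:ℝ) / 2 + 1) / (-(3:ℝ) / 2 + 1)) *
            ENNReal.ofReal (s ^ ((1:ℝ) / 2)) = 2 := by
          rw [← ENNReal.ofReal_mul' (by positivity), div_mul_eq_mul_div, neg_mul,
            ← Real.rpow_add hs']
          norm_num
        rw [mul_left_comm, mul_left_comm (ENNReal.ofReal _), e2]
        ring
    _ = 4 * ∫⁻ s in Ioi (0:ℝ), φ s ^ (2:ℝ) := lintegral_const_mul _ (by fun_prop)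

theorem FSeries_eq_tsum_fourier (c : ℤ → ℂ) (x : ℝ) :
    FSeries c x = ∑' n : ℤ, c n * fourier (T := 1) n (x : AddCircle (1:ℝ)) := by
  unfold FSeries
  congr 1 with n
  rw [fourier_coe_apply]
  congr 2
  push_cast
  ring

theorem norm_mul_fourier (c : ℤ → ℂ) (n : ℤ) (x : AddCircle (1:ℝ)) :
    ‖c n * fourier n x‖ = ‖c n‖ := by
  rw [norm_mul, fourier_apply, Circle.norm_coe, mul_one]

theorem summable_mul_fourier {c : ℤ → ℂ} (hc : Summable fun n => ‖c n‖) (x : AddCircle (1:ℝ)) :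
    Summable fun n => c n * fourier n x :=
  .of_norm (by simpa only [norm_mul_fourier] using hc)

theorem FSeries_add {c d : ℤ → ℂ} (hc : Summable fun n => ‖c n‖) (hd : Summable fun n => ‖d n‖)
    (x : ℝ) : FSeries (fun n => c n + d n) x = FSeries c x + FSeries d x := by
  simp only [FSeries_eq_tsum_fourier, add_mul]
  exact (summable_mul_fourier hc x).tsum_add (summable_mul_fourier hd x)

theorem enn_eq_enorm {α : Type*} (f : α → ℂ) (x : α) : enn f x = ‖f x‖ₑ :=
  ofReal_norm _

theorem enn_FSeries_le {c : ℤ → ℂ} (hc : Summable fun n => ‖c n‖) (x : ℝ) :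
    enn (FSeries c) x ≤ ∑' n, enn c n := by
  have h : ‖FSeries c x‖ ≤ ∑' n, ‖c n‖ := by
    rw [FSeries_eq_tsum_fourier]
    exact (norm_tsum_le_tsum_norm (summable_mul_fourier hc x).norm).trans_eq
      (by simp only [norm_mul_fourier])
  refine (ENNReal.ofReal_le_ofReal h).trans_eq ?_
  exact ENNReal.ofReal_tsum_of_nonneg (fun n => norm_nonneg _) hc

theorem measurable_FSeries {c : ℤ → ℂ} (hc : Summable fun n => ‖c n‖) :
    Measurable (FSeries c) := by
  refine (continuous_tsum (fun n => by fun_prop) hc fun n x => ?_).measurable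
  rw [norm_mul, Complex.norm_exp_ofReal_mul_I, mul_one]

/-- Parseval's identity for absolutely convergent Fourier series. -/
theorem lintegral_sq_FSeries {c : ℤ → ℂ} (hc : Summable fun n => ‖c n‖) :
    ∫⁻ x in Ico (0:ℝ) 1, enn (FSeries c) x ^ (2:ℝ) = ∑' n, enn c n ^ (2:ℝ) := by
  have hsum : Summable fun n => c n • (fourier n : C(AddCircle (1:ℝ), ℂ)) :=
    .of_norm (by simpa only [norm_smul, fourier_norm, mul_one] using hc)
  set F : C(AddCircle (1:ℝ), ℂ) := ∑' n, c n • fourier n with hF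
  have hFx : ∀ x : ℝ, F x = FSeries c x := by
    intro x
    rw [FSeries_eq_tsum_fourier, hF, ← ContinuousMap.tsum_apply hsum (x : AddCircle (1:ℝ))]
    rfl
  set T := ContinuousMap.toLp (E := ℂ) 2 (AddCircle.haarAddCircle (T := (1:ℝ))) ℂ
  have hL : HasSum (fun n => c n • fourierBasis (T := (1:ℝ)) n) (T F) := by
    have := hsum.hasSum.mapL T
    simpa only [map_smul, coe_fourierBasis] using this
  have hcoef : ∀ n, fourierCoeff (T F) n = c n := by
    intro n
    rw [← fourierBasis_repr, HilbertBasis.repr_apply_apply]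
    have h1 := hL.mapL (innerSL ℂ (fourierBasis (T := (1:ℝ)) n))
    refine h1.unique ?_
    have hn : c n = innerSL ℂ (fourierBasis (T := (1:ℝ)) n)
        (c n • fourierBasis (T := (1:ℝ)) n) := by
      simp only [innerSL_apply_apply, inner_smul_right,
        orthonormal_iff_ite.1 (fourierBasis (T := (1:ℝ))).orthonormal]
      simp
    rw [hn]
    refine hasSum_single n fun m hm => ?_
    simp only [innerSL_apply_apply, inner_smul_right,
      orthonormal_iff_ite.1 (fourierBasis (T := (1:ℝ))).orthonormal]
    simp [hm.symm]
  have hP := hasSum_sq_fourierCoeff (T F)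
  simp only [hcoef] at hP
  have hTF : ∫ t, ‖(T F) t‖ ^ 2 ∂AddCircle.haarAddCircle (T := (1:ℝ)) =
      ∫ t, ‖F t‖ ^ 2 ∂AddCircle.haarAddCircle (T := (1:ℝ)) := by
    refine integral_congr_ae ?_
    filter_upwards [ContinuousMap.coeFn_toLp (p := 2) (𝕜 := ℂ)
      (AddCircle.haarAddCircle (T := (1:ℝ))) F] with t ht
    rw [ht]
  rw [hTF] at hP
  have hvol : (volume : Measure (AddCircle (1:ℝ))) = AddCircle.haarAddCircle := by
    rw [AddCircle.volume_eq_smul_haarAddCircle, ENNReal.ofReal_one, one_smul]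
  have hrpow : ∀ z : ℂ, ENNReal.ofReal (‖z‖ ^ 2) = ENNReal.ofReal ‖z‖ ^ (2:ℝ) := fun z => by
    rw [ENNReal.ofReal_pow (norm_nonneg _), ENNReal.rpow_two]
  calc ∫⁻ x in Ico (0:ℝ) 1, enn (FSeries c) x ^ (2:ℝ)
      = ∫⁻ x in Ioc (0:ℝ) (0 + 1), ENNReal.ofReal (‖F (x : AddCircle (1:ℝ))‖ ^ 2) := by
        rw [zero_add, ← restrict_Ico_eq_restrict_Ioc]
        simp only [hFx, hrpow, enn]
    _ = ∫⁻ x : AddCircle (1:ℝ), ENNReal.ofReal (‖F x‖ ^ 2) :=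
        UnitAddCircle.lintegral_preimage 0 fun x => ENNReal.ofReal (‖F x‖ ^ 2)
    _ = ENNReal.ofReal (∫ t, ‖F t‖ ^ 2 ∂AddCircle.haarAddCircle (T := (1:ℝ))) := by
        rw [hvol, ofReal_integral_eq_lintegral_ofReal]
        · exact (F.continuous.norm.pow 2).integrable_of_hasCompactSupport
            (HasCompactSupport.of_compactSpace _)
        · exact Filter.Eventually.of_forall fun t => by positivity
    _ = ∑' n, enn c n ^ (2:ℝ) := by
        rw [← hP.tsum_eq, ENNReal.ofReal_tsum_of_nonneg (fun n => by positivity) hP.summable]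
        simp only [hrpow, enn]

theorem circRearr_le_add {f g h : ℝ → ℂ} {A : ℝ≥0∞} (hf : ∀ x, f x = g x + h x)
    (hg : ∀ x, enn g x ≤ A) (s : ℝ) : circRearr f s ≤ A + circRearr h s := by
  unfold circRearr rearr
  rw [ENNReal.add_sInf]
  refine le_iInf₂ fun l hl => sInf_le (le_trans (measure_mono fun x hx => ?_) hl)
  have h1 : enn f x ≤ A + enn h x := by
    simp only [enn_eq_enorm, hf] at hg ⊢
    exact (enorm_add_le _ _).trans (by gcongr; exact hg x)
  by_contra! hcon
  exact absurd (h1.trans (add_le_add_right (not_lt.1 hcon) A)) (not_le.2 hx)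

theorem measurable_circRearr (f : ℝ → ℂ) : Measurable (circRearr f) :=
  (antitone_rearr _ _).measurable

theorem measurable_circMaxRearr (f : ℝ → ℂ) : Measurable (circMaxRearr f) := by
  have h : Monotone fun t : ℝ => ∫⁻ s in Ioo (0:ℝ) t, circRearr f s := fun t u htu =>
    lintegral_mono_set (Ioo_subset_Ioo_right htu)
  exact ENNReal.measurable_ofReal.inv.mul h.measurable

theorem circMaxRearr_le_add {f g h : ℝ → ℂ} {A : ℝ≥0∞} (hf : ∀ x, f x = g x + h x)
    (hg : ∀ x, enn g x ≤ A) {t : ℝ} (ht : 0 < t) :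
    circMaxRearr f t ≤ A + circMaxRearr h t := by
  unfold circMaxRearr
  have h1 : ∫⁻ s in Ioo (0:ℝ) t, circRearr f s ≤
      A * ENNReal.ofReal t + ∫⁻ s in Ioo (0:ℝ) t, circRearr h s := by
    refine (lintegral_mono fun s => circRearr_le_add hf hg s).trans_eq ?_
    rw [lintegral_add_left measurable_const, setLIntegral_const, Real.volume_Ioo, sub_zero]
  refine (mul_le_mul_right h1 _).trans_eq ?_
  rw [mul_add, mul_left_comm, ENNReal.inv_mul_cancel (by simpa using ht) ENNReal.ofReal_ne_top,
    mul_one]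

theorem mul_seqMaxRearr (b : ℤ → ℝ≥0∞) {N : ℕ} (hN : 1 ≤ N) :
    N * seqMaxRearr b N = ∑ i ∈ Finset.range N, seqRearr b i := by
  unfold seqMaxRearr
  rw [← mul_assoc, ENNReal.mul_inv_cancel (by simp; omega) (by simp), one_mul]

theorem seqRearr_le_seqMaxRearr (b : ℤ → ℝ≥0∞) {N : ℕ} (hN : 1 ≤ N) :
    seqRearr b N ≤ seqMaxRearr b N := by
  refine (ENNReal.mul_le_mul_iff_right (a := (N : ℝ≥0∞)) (by simp; omega) (by simp)).1 ?_
  rw [mul_seqMaxRearr b hN]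
  simpa using Finset.card_nsmul_le_sum (Finset.range N) (seqRearr b) (seqRearr b N)
    fun i hi => antitone_seqRearr b (Finset.mem_range.1 hi).le

theorem seqMaxRearr_le_two_mul (b : ℤ → ℝ≥0∞) {N k : ℕ} (hN : 1 ≤ N) (hk : k ≤ N) :
    seqMaxRearr b N ≤ 2 * seqMaxRearr b (N + k) := by
  refine (ENNReal.mul_le_mul_iff_right (a := (N : ℝ≥0∞)) (by simp; omega) (by simp)).1 ?_
  rw [mul_seqMaxRearr b hN]
  calc ∑ i ∈ Finset.range N, seqRearr b i ≤ ∑ i ∈ Finset.range (N + k), seqRearr b i :=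
        Finset.sum_le_sum_of_subset (Finset.range_subset_range.2 (by omega))
    _ = ((N + k : ℕ) : ℝ≥0∞) * seqMaxRearr b (N + k) := (mul_seqMaxRearr b (by omega)).symm
    _ ≤ ((N * 2 : ℕ) : ℝ≥0∞) * seqMaxRearr b (N + k) := by gcongr; omega
    _ = _ := by push_cast; ring

theorem mul_sq_seqMaxRearr_le (b : ℤ → ℝ≥0∞) {N : ℕ} (hN : 1 ≤ N) :
    N * seqMaxRearr b N ^ (2:ℝ) ≤ 4 * ∑' k, seqMaxRearr b (N + k) ^ (2:ℝ) := by
  calc N * seqMaxRearr b N ^ (2:ℝ)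
      = ∑ k ∈ Finset.range N, seqMaxRearr b N ^ (2:ℝ) := by simp
    _ ≤ ∑ k ∈ Finset.range N, 4 * seqMaxRearr b (N + k) ^ (2:ℝ) := by
        refine Finset.sum_le_sum fun k hk => ?_
        refine (ENNReal.rpow_le_rpow (seqMaxRearr_le_two_mul b hN (Finset.mem_range.1 hk).le)
          (by norm_num)).trans_eq ?_
        rw [ENNReal.mul_rpow_of_nonneg _ _ (by norm_num)]
        norm_num
    _ ≤ _ := by
        rw [← Finset.mul_sum]
        gcongr
        exact ENNReal.sum_le_tsum _

/-- The square function of `f^{**}` near `0` is controlled by the tail sums of `(a^{**})²`. -/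
theorem setLIntegral_sq_circMaxRearr_FSeries_le {a : ℤ → ℂ} (ha : Summable fun n => ‖a n‖)
    {N : ℕ} (hN : 1 ≤ N) :
    ∫⁻ t in Ioo (0:ℝ) (1 / N), circMaxRearr (FSeries a) t ^ (2:ℝ) ≤
      48 * ∑' k, seqMaxRearr (enn a) (N + k) ^ (2:ℝ) := by
  classical
  set b := enn a with hb_def
  set B : ℝ≥0∞ := ∑' n, b n with hB_def
  have hB : B ≠ ∞ := by
    rw [hB_def, hb_def]
    unfold enn
    rw [← ENNReal.ofReal_tsum_of_nonneg (fun n => norm_nonneg _) ha]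
    exact ENNReal.ofReal_ne_top
  have hb : ∀ n, b n ≤ B := fun n => ENNReal.le_tsum n
  set L := seqRearr b N
  set D := seqMaxRearr b N
  set S := ∑' k, seqMaxRearr b (N + k) ^ (2:ℝ)
  let c : ℤ → ℂ := fun n => if L < b n then a n else 0
  let d : ℤ → ℂ := fun n => if L < b n then 0 else a n
  have hc : Summable fun n => ‖c n‖ := ha.of_nonneg_of_le (fun n => norm_nonneg _) fun n => by
    simp only [c]; split_ifs <;> simp
  have hd : Summable fun n => ‖d n‖ := ha.of_nonneg_of_le (fun n => norm_nonneg _) fun n => by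
    simp only [d]; split_ifs <;> simp
  have hcb : ∀ n, enn c n = if L < b n then b n else 0 := fun n => by
    simp only [hb_def, enn, c]; split_ifs <;> simp
  have hdb : ∀ n, enn d n = if L < b n then 0 else b n := fun n => by
    simp only [hb_def, enn, d]; split_ifs <;> simp
  have hsplit : ∀ x, FSeries a x = FSeries c x + FSeries d x := fun x => by
    rw [← FSeries_add hc hd]
    congr 1 with n
    simp only [c, d]; split_ifs <;> simp
  have hcA : ∀ x, enn (FSeries c) x ≤ N * D := fun x => by
    rw [mul_seqMaxRearr b hN]
    refine (enn_FSeries_le hc x).trans ?_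
    simp only [hcb]
    exact tsum_indicator_lt_seqRearr_le hB hb N
  have hND : N * D ^ (2:ℝ) ≤ 4 * S := mul_sq_seqMaxRearr_le b hN
  have htail : ∑' n, enn d n ^ (2:ℝ) ≤ 5 * S := by
    simp only [hdb]
    refine (tsum_sq_indicator_le_seqRearr_le hB hb N).trans ?_
    calc _ ≤ N * D ^ (2:ℝ) + S := by
          gcongr
          · exact seqRearr_le_seqMaxRearr b hN
          · refine ENNReal.tsum_le_tsum fun j => ?_
            rw [add_comm j]
            gcongr
            exact seqRearr_le_seqMaxRearr b (by omega)
      _ ≤ 4 * S + S := by gcongr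
      _ = 5 * S := by ring
  have hrearr : ∫⁻ s in Ioi (0:ℝ), circRearr (FSeries d) s ^ (2:ℝ) ≤ ∑' n, enn d n ^ (2:ℝ) := by
    rw [← lintegral_sq_FSeries hd]
    have hdB : ∀ x, enn (FSeries d) x ≤ B := fun x =>
      (enn_FSeries_le hd x).trans (ENNReal.tsum_le_tsum fun n => by
        rw [hdb]; split_ifs <;> simp)
    refine lintegral_sq_le_of_meas_lt_le (measurable_circRearr _) ?_ (fun s => ?_)
      (fun x => ne_top_of_le_ne_top hB (hdB x)) fun l => volume_lt_rearr_le _ _ l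
    · exact ENNReal.measurable_ofReal.comp (measurable_FSeries hd).norm
    · refine ne_top_of_le_ne_top hB (sInf_le ?_)
      have : {x | B < enn (FSeries d) x} = ∅ :=
        eq_empty_of_forall_notMem fun x hx => absurd (hdB x) (not_le.2 hx)
      simp [this]
  have hhardy : ∫⁻ t in Ioo (0:ℝ) (1 / N), circMaxRearr (FSeries d) t ^ (2:ℝ) ≤ 20 * S := by
    refine (lintegral_mono_set Ioo_subset_Ioi_self).trans
      ((hardy_sq (measurable_circRearr (FSeries d))).trans ?_)
    calc _ ≤ 4 * (5 * S) := by gcongr; exact hrearr.trans htail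
      _ = 20 * S := by ring
  calc ∫⁻ t in Ioo (0:ℝ) (1 / N), circMaxRearr (FSeries a) t ^ (2:ℝ)
      ≤ ∫⁻ t in Ioo (0:ℝ) (1 / N),
          2 * ((N * D) ^ (2:ℝ) + circMaxRearr (FSeries d) t ^ (2:ℝ)) := by
        refine setLIntegral_mono' measurableSet_Ioo fun t ht => ?_
        refine (ENNReal.rpow_le_rpow (circMaxRearr_le_add hsplit hcA ht.1)
          (by norm_num)).trans ((ENNReal.rpow_add_le_mul_rpow_add_rpow _ _ (by norm_num)).trans_eq
            (by norm_num))
    _ = 2 * (N * D ^ (2:ℝ) +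
          ∫⁻ t in Ioo (0:ℝ) (1 / N), circMaxRearr (FSeries d) t ^ (2:ℝ)) := by
        have hN0 : (N : ℝ≥0∞) ≠ 0 := by simp; omega
        rw [lintegral_const_mul' _ _ (by simp), lintegral_add_left measurable_const,
          setLIntegral_const, Real.volume_Ioo, sub_zero, one_div, ENNReal.ofReal_inv_of_pos
          (by exact_mod_cast hN), ENNReal.ofReal_natCast,
          ENNReal.mul_rpow_of_nonneg _ _ (by norm_num), ENNReal.rpow_two (N : ℝ≥0∞), sq,
          mul_right_comm, mul_assoc (N : ℝ≥0∞), ENNReal.mul_inv_cancel hN0 (by simp), mul_one]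
    _ ≤ 2 * (4 * S + 20 * S) := by gcongr
    _ = 48 * S := by ring

theorem setLIntegral_ofReal_inv_Ico {u v : ℝ} (hu : 0 < u) (huv : u ≤ v) :
    ∫⁻ t in Ico u v, ENNReal.ofReal t⁻¹ = ENNReal.ofReal (Real.log (v / u)) := by
  have h1 : IntervalIntegrable (fun t : ℝ => t⁻¹) volume u v :=
    intervalIntegral.intervalIntegrable_inv (fun t ht => by
      rw [uIcc_of_le huv] at ht
      exact (hu.trans_le ht.1).ne') continuousOn_id
  have h2 := integral_inv_of_pos hu (hu.trans_le huv)
  rw [intervalIntegral.integral_of_le huv] at h2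
  rw [restrict_Ico_eq_restrict_Ioc, ← h2, ofReal_integral_eq_lintegral_ofReal
    ((intervalIntegrable_iff_integrableOn_Ioc_of_le huv).1 h1)]
  filter_upwards [self_mem_ae_restrict measurableSet_Ioc] with t ht
  exact inv_nonneg.2 (hu.trans ht.1).le

theorem setLIntegral_lorentz_Ico_le {q : ℝ} (hq0 : 0 < q) (hq2 : q < 2) {G : ℝ → ℝ≥0∞}
    (hG : Measurable G) {u v : ℝ} (hu : 0 < u) (huv : u ≤ v) :
    ∫⁻ t in Ico u v, (ENNReal.ofReal (t ^ ((1:ℝ) / 2)) * G t) ^ q * (ENNReal.ofReal t)⁻¹ ≤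
      (∫⁻ t in Ioo 0 v, G t ^ (2:ℝ)) ^ (q / 2) *
        ENNReal.ofReal (Real.log (v / u)) ^ (1 - q / 2) := by
  have hpq : (2 / q).HolderConjugate (1 / (1 - q / 2)) := by
    rw [Real.holderConjugate_iff]
    refine ⟨(one_lt_div hq0).2 hq2, ?_⟩
    rw [inv_div, one_div, inv_inv]
    ring
  have h := ENNReal.lintegral_mul_le_Lp_mul_Lq (volume.restrict (Ico u v)) hpq
    (f := fun t => G t ^ q) (g := fun t => ENNReal.ofReal (t ^ (-(1 - q / 2))))
    (by fun_prop) (by fun_prop)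
  have e1 : ∫⁻ t in Ico u v,
      (ENNReal.ofReal (t ^ ((1:ℝ) / 2)) * G t) ^ q * (ENNReal.ofReal t)⁻¹ =
      ∫⁻ t in Ico u v, ((fun t => G t ^ q) *
        fun t => ENNReal.ofReal (t ^ (-(1 - q / 2)))) t := by
    refine setLIntegral_congr_fun measurableSet_Ico fun t ht => ?_
    have ht0 : 0 < t := hu.trans_le ht.1
    simp only [Pi.mul_apply]
    rw [ENNReal.mul_rpow_of_nonneg _ _ hq0.le,
      ENNReal.ofReal_rpow_of_pos (Real.rpow_pos_of_pos ht0 _), ← ENNReal.ofReal_inv_of_pos ht0,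
      mul_right_comm, ← ENNReal.ofReal_mul (by positivity), mul_comm, ← Real.rpow_mul ht0.le,
      ← Real.rpow_neg_one t, ← Real.rpow_add ht0]
    congr 3
    ring
  have e2 : ∫⁻ t in Ico u v, (G t ^ q) ^ (2 / q) = ∫⁻ t in Ico u v, G t ^ (2:ℝ) := by
    simp only [← ENNReal.rpow_mul, mul_div_cancel₀ _ hq0.ne']
  have e3 : ∫⁻ t in Ico u v, ENNReal.ofReal (t ^ (-(1 - q / 2))) ^ (1 / (1 - q / 2)) =
      ENNReal.ofReal (Real.log (v / u)) := by
    rw [← setLIntegral_ofReal_inv_Ico hu huv]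
    refine setLIntegral_congr_fun measurableSet_Ico fun t ht => ?_
    have ht0 : 0 < t := hu.trans_le ht.1
    have : 1 - q / 2 ≠ 0 := by linarith
    rw [ENNReal.ofReal_rpow_of_pos (Real.rpow_pos_of_pos ht0 _), ← Real.rpow_mul ht0.le,
      neg_mul, mul_one_div_cancel this, Real.rpow_neg_one]
  rw [e1]
  refine h.trans ?_
  rw [e2, e3, one_div_div, one_div_one_div]
  gcongr

/-- The doubly exponential scale `1, 2, 4, 16, 256, …`. -/
def dblExp : ℕ → ℕ
  | 0 => 1
  | k + 1 => 2 ^ 2 ^ k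

theorem one_le_dblExp (k : ℕ) : 1 ≤ dblExp k := by
  cases k
  · exact le_rfl
  · exact Nat.one_le_two_pow

theorem dblExp_le_succ (k : ℕ) : dblExp k ≤ dblExp (k + 1) := by
  cases k
  · exact Nat.one_le_two_pow
  · exact Nat.pow_le_pow_right (by norm_num) (Nat.pow_le_pow_right (by norm_num) (by omega))

theorem lt_dblExp_succ (k : ℕ) : k < dblExp (k + 1) :=
  Nat.lt_two_pow_self.trans Nat.lt_two_pow_self

theorem log_dblExp_succ (k : ℕ) : Real.log (dblExp (k + 1)) = 2 ^ k * Real.log 2 := by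
  simp only [dblExp]
  push_cast
  rw [Real.log_pow]
  push_cast
  rfl

theorem log_dblExp_succ_le (k : ℕ) : Real.log (dblExp (k + 1)) ≤ 2 ^ k := by
  rw [log_dblExp_succ]
  have := Real.log_two_lt_d9
  have h2 : (0:ℝ) < 2 ^ k := by positivity
  nlinarith

theorem le_log_dblExp_sub (k : ℕ) :
    (2:ℝ) ^ (k + 1) / 8 ≤ Real.log (dblExp (k + 1)) - Real.log (dblExp k) := by
  have := Real.log_two_gt_d9
  cases k with
  | zero =>
    rw [log_dblExp_succ]
    simp only [dblExp]
    norm_num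
    linarith
  | succ k =>
    rw [log_dblExp_succ, log_dblExp_succ]
    have h2 : (0:ℝ) < 2 ^ k := by positivity
    rw [pow_succ, pow_succ]
    nlinarith

theorem Ioo_zero_one_subset_iUnion_dblExp :
    Ioo (0:ℝ) 1 ⊆ ⋃ k, Ico (1 / (dblExp (k + 1) : ℝ)) (1 / (dblExp k : ℝ)) := by
  classical
  intro t ht
  have hex : ∃ k, 1 / (dblExp (k + 1) : ℝ) ≤ t := by
    obtain ⟨k, hk⟩ := exists_nat_gt (1 / t)
    refine ⟨k, (one_div_le (by exact_mod_cast one_le_dblExp _) ht.1).2 (hk.le.trans ?_)⟩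
    exact_mod_cast (lt_dblExp_succ k).le
  refine mem_iUnion.2 ⟨Nat.find hex, Nat.find_spec hex, ?_⟩
  cases hK : Nat.find hex with
  | zero => simpa [dblExp] using ht.2
  | succ k => exact not_le.1 (Nat.find_min hex (by omega))

theorem log_sub_log_le_sum_Ico {A B : ℕ} (hA : 1 ≤ A) (hAB : A ≤ B) :
    Real.log B - Real.log A ≤ ∑ m ∈ Finset.Ico (A - 1) (B - 1), ((m : ℝ) + 1)⁻¹ := by
  induction B, hAB using Nat.le_induction with
  | base => simp
  | succ n hn ih =>
    have e : n + 1 - 1 = (n - 1) + 1 := by omega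
    rw [e, Finset.sum_Ico_succ_top (by omega)]
    have hn0 : (0:ℝ) < n := by exact_mod_cast (by omega : 0 < n)
    have h1 : ((n - 1 : ℕ) : ℝ) + 1 = n := by exact_mod_cast (by omega : n - 1 + 1 = n)
    have h2 : Real.log ((n + 1 : ℕ) : ℝ) - Real.log n ≤ (n : ℝ)⁻¹ := by
      rw [← Real.log_div (by positivity) hn0.ne']
      refine (Real.log_le_sub_one_of_pos (by positivity)).trans_eq ?_
      push_cast
      field_simp
      ring
    rw [h1]
    linarith

/-- The weight `1 / (n log^{q/2}(n+1))`, at `n = m + 1`. -/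
def logWeight (q : ℝ) (m : ℕ) : ℝ≥0∞ :=
  (ENNReal.ofReal (((m : ℝ) + 1) * Real.log ((m : ℝ) + 2) ^ (q / 2)))⁻¹

theorem two_pow_rpow_le_sum_logWeight {q : ℝ} (hq0 : 0 < q) (k : ℕ) :
    ENNReal.ofReal (2 ^ (k + 1)) ^ (1 - q / 2) ≤
      8 * ∑ m ∈ Finset.Ico (dblExp k - 1) (dblExp (k + 1) - 1), logWeight q m := by
  set P : ℝ := 2 ^ (k + 1) with hP
  have hP0 : 0 < P := by positivity
  have hw : ∀ m ∈ Finset.Ico (dblExp k - 1) (dblExp (k + 1) - 1),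
      ENNReal.ofReal (((m : ℝ) + 1)⁻¹ * P ^ (-(q / 2))) ≤ logWeight q m := by
    intro m hm
    have hm' := (Finset.mem_Ico.1 hm).2
    have hlog0 : 0 < Real.log ((m : ℝ) + 2) := Real.log_pos (by linarith [m.cast_nonneg (α := ℝ)])
    have hlog : Real.log ((m : ℝ) + 2) ≤ P := by
      have h1 : ((m : ℝ) + 2) ≤ dblExp (k + 1) := by
        exact_mod_cast (by omega : m + 2 ≤ dblExp (k + 1))
      refine (Real.log_le_log (by positivity) h1).trans ((log_dblExp_succ_le k).trans ?_)
      exact pow_le_pow_right₀ (by norm_num) (by omega)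
    unfold logWeight
    rw [← ENNReal.ofReal_inv_of_pos (by positivity), mul_inv, Real.rpow_neg hP0.le]
    gcongr
  have h8 : (8:ℝ≥0∞) = ENNReal.ofReal 8 := by simp
  calc ENNReal.ofReal P ^ (1 - q / 2)
      = ENNReal.ofReal (8 * (P / 8 * P ^ (-(q / 2)))) := by
        rw [ENNReal.ofReal_rpow_of_pos hP0, sub_eq_add_neg, Real.rpow_add hP0, Real.rpow_one]
        congr 1
        ring
    _ ≤ ENNReal.ofReal (8 * ∑ m ∈ Finset.Ico (dblExp k - 1) (dblExp (k + 1) - 1),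
          ((m : ℝ) + 1)⁻¹ * P ^ (-(q / 2))) := by
        rw [← Finset.sum_mul]
        gcongr
        exact (le_log_dblExp_sub k).trans
          (log_sub_log_le_sum_Ico (one_le_dblExp k) (dblExp_le_succ k))
    _ ≤ _ := by
        rw [ENNReal.ofReal_mul (by norm_num), ← h8,
          ENNReal.ofReal_sum_of_nonneg fun m _ => by positivity]
        gcongr with m hm
        exact hw m hm

theorem one_le_logWeight_zero {q : ℝ} (hq0 : 0 < q) : 1 ≤ logWeight q 0 := by
  unfold logWeight
  rw [ENNReal.one_le_inv, ENNReal.ofReal_le_one]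
  have h1 := Real.log_two_lt_d9
  simpa using Real.rpow_le_one (Real.log_nonneg (by norm_num)) (by linarith : Real.log 2 ≤ 1)
    (by positivity : 0 ≤ q / 2)

theorem tsum_sum_Ico_dblExp_le (W : ℕ → ℝ≥0∞) :
    ∑' k, ∑ m ∈ Finset.Ico (dblExp k - 1) (dblExp (k + 1) - 1), W m ≤ ∑' m, W m := by
  refine ENNReal.tsum_le_of_sum_range_le fun n => ?_
  have hmono : Monotone fun k => dblExp k - 1 :=
    monotone_nat_of_le_succ fun k => Nat.sub_le_sub_right (dblExp_le_succ k) 1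
  have h : ∑ k ∈ Finset.range n, ∑ m ∈ Finset.Ico (dblExp k - 1) (dblExp (k + 1) - 1), W m =
      ∑ m ∈ Finset.Ico (dblExp 0 - 1) (dblExp n - 1), W m := by
    induction n with
    | zero => simp
    | succ n ih =>
      rw [Finset.sum_range_succ, ih, Finset.sum_Ico_consecutive _ (hmono n.zero_le)
        (hmono n.le_succ)]
  rw [h]
  exact ENNReal.sum_le_tsum _

theorem lintegral_lorentz_le {q : ℝ} (hq0 : 0 < q) (hq2 : q < 2) {G : ℝ → ℝ≥0∞}
    (hG : Measurable G) {S : ℕ → ℝ≥0∞} (hS : Antitone S) {C : ℝ≥0∞}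
    (h : ∀ N : ℕ, 1 ≤ N → ∫⁻ t in Ioo (0:ℝ) (1 / N), G t ^ (2:ℝ) ≤ C * S N) :
    ∫⁻ t in Ioo (0:ℝ) 1, (ENNReal.ofReal (t ^ ((1:ℝ) / 2)) * G t) ^ q * (ENNReal.ofReal t)⁻¹ ≤
      C ^ (q / 2) * 9 * ∑' m, S (m + 1) ^ (q / 2) * logWeight q m := by
  set W : ℕ → ℝ≥0∞ := fun m => S (m + 1) ^ (q / 2) * logWeight q m with hW
  have hq : 0 ≤ q / 2 := by positivity
  have hq' : 0 ≤ 1 - q / 2 := by linarith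
  have hblock : ∀ k, ∫⁻ t in Ico (1 / (dblExp (k + 1) : ℝ)) (1 / (dblExp k : ℝ)),
      (ENNReal.ofReal (t ^ ((1:ℝ) / 2)) * G t) ^ q * (ENNReal.ofReal t)⁻¹ ≤
      C ^ (q / 2) * (S (dblExp k) ^ (q / 2) * ENNReal.ofReal (2 ^ k) ^ (1 - q / 2)) := by
    intro k
    have h0 : (1:ℝ) ≤ dblExp k := by exact_mod_cast one_le_dblExp k
    have h1 : (dblExp k : ℝ) ≤ dblExp (k + 1) := by exact_mod_cast dblExp_le_succ k
    have h0' : (0:ℝ) < dblExp k := by linarith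
    have h1' : (0:ℝ) < dblExp (k + 1) := by linarith
    refine (setLIntegral_lorentz_Ico_le hq0 hq2 hG (one_div_pos.2 h1')
      (one_div_le_one_div_of_le h0' h1)).trans ?_
    rw [← mul_assoc, ← ENNReal.mul_rpow_of_nonneg _ _ hq]
    gcongr
    · exact h _ (one_le_dblExp k)
    · refine le_trans (Real.log_le_log (by positivity) ?_) (log_dblExp_succ_le k)
      rw [div_div_div_cancel_left' _ _ one_ne_zero]
      exact div_le_self h1'.le h0
  have hzero : S (dblExp 0) ^ (q / 2) * ENNReal.ofReal (2 ^ 0) ^ (1 - q / 2) ≤ ∑' m, W m := by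
    refine le_trans ?_ (ENNReal.le_tsum 0)
    simp only [pow_zero, ENNReal.ofReal_one, ENNReal.one_rpow]
    exact mul_le_mul' le_rfl (one_le_logWeight_zero hq0)
  have hsucc : ∀ k, S (dblExp (k + 1)) ^ (q / 2) * ENNReal.ofReal (2 ^ (k + 1)) ^ (1 - q / 2) ≤
      8 * ∑ m ∈ Finset.Ico (dblExp k - 1) (dblExp (k + 1) - 1), W m := by
    intro k
    refine (mul_le_mul' le_rfl (two_pow_rpow_le_sum_logWeight hq0 k)).trans ?_
    rw [mul_left_comm, Finset.mul_sum]
    gcongr with m hm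
    have := (Finset.mem_Ico.1 hm).2
    exact mul_le_mul' (ENNReal.rpow_le_rpow (hS (by omega)) hq) le_rfl
  calc _ ≤ ∑' k, ∫⁻ t in Ico (1 / (dblExp (k + 1) : ℝ)) (1 / (dblExp k : ℝ)),
          (ENNReal.ofReal (t ^ ((1:ℝ) / 2)) * G t) ^ q * (ENNReal.ofReal t)⁻¹ :=
        (lintegral_mono_set Ioo_zero_one_subset_iUnion_dblExp).trans (lintegral_iUnion_le _ _)
    _ ≤ ∑' k, C ^ (q / 2) *
          (S (dblExp k) ^ (q / 2) * ENNReal.ofReal (2 ^ k) ^ (1 - q / 2)) :=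
        ENNReal.tsum_le_tsum hblock
    _ ≤ C ^ (q / 2) * (∑' m, W m + 8 * ∑' m, W m) := by
        rw [ENNReal.tsum_mul_left, tsum_eq_zero_add' ENNReal.summable]
        gcongr
        refine (ENNReal.tsum_le_tsum hsucc).trans ?_
        rw [ENNReal.tsum_mul_left]
        exact mul_le_mul' le_rfl (tsum_sum_Ico_dblExp_le W)
    _ = _ := by ring

/-- For `1 ≤ q < 2` and a summable sequence `a`,
`‖∑ a_n e^{2πin·}‖_{L^{2,q}[0,1)} ≲_q (∑_n (∑_{j≥n} (a_j^{**})²)^{q/2} (n log^{q/2}(n+1))⁻¹)^{1/q}`. -/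
theorem statement19 (q : ℝ) (hq1 : 1 ≤ q) (hq2 : q < 2) :
    ∃ K : ℝ≥0∞, 0 < K ∧ K < ∞ ∧
      ∀ a : ℤ → ℂ, Summable (fun n => ‖a n‖) →
        lorentz2 q (FSeries a) ≤
          K * (∑' m : ℕ,
              (∑' k : ℕ, seqMaxRearr (enn a) (m + 1 + k) ^ (2:ℝ)) ^ (q / 2) *
                (ENNReal.ofReal (((m : ℝ) + 1) * Real.log ((m : ℝ) + 2) ^ (q / 2)))⁻¹) ^ (1 / q) := by
  have hq0 : 0 < q := by linarith
  have hK0 : (48:ℝ≥0∞) ^ (q / 2) * 9 ≠ 0 := by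
    simp [ENNReal.rpow_eq_zero_iff]
  have hKt : (48:ℝ≥0∞) ^ (q / 2) * 9 ≠ ∞ :=
    ENNReal.mul_ne_top (ENNReal.rpow_ne_top_of_nonneg (by positivity) (by simp)) (by simp)
  refine ⟨((48:ℝ≥0∞) ^ (q / 2) * 9) ^ (1 / q), ENNReal.rpow_pos (pos_iff_ne_zero.2 hK0) hKt,
    (ENNReal.rpow_ne_top_of_nonneg (by positivity) hKt).lt_top, fun a ha => ?_⟩
  have hS : Antitone fun N => ∑' k, seqMaxRearr (enn a) (N + k) ^ (2:ℝ) := by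
    intro N N' hN
    have e : ∀ k, N' + k = N + (k + (N' - N)) := fun k => by omega
    simp only [e]
    exact ENNReal.tsum_comp_le_tsum_of_injective (add_left_injective (N' - N))
      fun k => seqMaxRearr (enn a) (N + k) ^ (2:ℝ)
  rw [← ENNReal.mul_rpow_of_nonneg _ _ (by positivity)]
  exact ENNReal.rpow_le_rpow (lintegral_lorentz_le hq0 hq2 (measurable_circMaxRearr _) hS
    fun N hN => setLIntegral_sq_circMaxRearr_FSeries_le ha hN) (by positivity)
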